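/- arXiv:1304.2144 — 6 statements merged into one kernel-verified Lean document; each statement's English description precedes it below -/
import Mathlib

section
/- (Theorem 1, iterative property of the PTD sub-function) Let c_1,…,c_L (L ≥ 2) be points with real pick-up probabilities P(c_i) and real pairwise distances D. Then F1(c_1,…,c_L) = (1−P(c_2))·F1(c_2,…,c_L) + D_{c_1,c_2}·PE(P(c_2),…,P(c_L)). -/
/-- The probability summation function `PE(p_1,…,p_L) = Σ_{k=1}^{L} (∏_{i=1}^{k−1}(1−p_i))·p_k`
(written with 0-based indices: `p 0, …, p (L-1)`); the empty product equals 1. -/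
noncomputable def PE (L : ℕ) (p : ℕ → ℝ) : ℝ :=
  ∑ k ∈ Finset.range L, (∏ i ∈ Finset.range k, (1 - p i)) * p k

/-- The PTD sub-function of a sequence of points `c_1,…,c_L` (0-based: `c 0,…,c (L-1)`):
`F1(c_1,…,c_L) = Σ_{k=2}^{L} (Σ_{i=2}^{k} D_{c_{i−1},c_i})·(∏_{i=2}^{k−1}(1−P(c_i)))·P(c_k)`,
with `F1(c_1) = 0` when `L = 1`. -/
noncomputable def F1seq {α : Type*} (L : ℕ) (c : ℕ → α) (P : α → ℝ) (D : α → α → ℝ) : ℝ :=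
  ∑ k ∈ Finset.Ico 1 L,
    (∑ i ∈ Finset.Icc 1 k, D (c (i - 1)) (c i)) *
      ((∏ i ∈ Finset.Ico 1 k, (1 - P (c i))) * P (c k))

/-- `F1seq` as a sum over ranges. -/
theorem F1seq_succ {α : Type*} (n : ℕ) (c : ℕ → α) (P : α → ℝ) (D : α → α → ℝ) :
    F1seq (n + 1) c P D =
      ∑ k ∈ Finset.range n,
        (∑ i ∈ Finset.range (k + 1), D (c i) (c (i + 1))) *
          ((∏ i ∈ Finset.range k, (1 - P (c (i + 1)))) * P (c (k + 1))) := by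
  simp only [F1seq, ← Finset.Ico_add_one_right_eq_Icc, Finset.sum_Ico_eq_sum_range,
    Finset.prod_Ico_eq_prod_range, Nat.add_sub_cancel, Nat.add_comm 1]

/-- Theorem 1, iterative property of the PTD sub-function:
for points `c_1,…,c_L` (`L ≥ 2`),
`F1(c_1,…,c_L) = (1−P(c_2))·F1(c_2,…,c_L) + D_{c_1,c_2}·PE(P(c_2),…,P(c_L))`. -/
theorem F1_iterative {α : Type*} (L : ℕ) (hL : 2 ≤ L) (c : ℕ → α)
    (P : α → ℝ) (D : α → α → ℝ) :
    F1seq L c P D =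
      (1 - P (c 1)) * F1seq (L - 1) (fun i => c (i + 1)) P D +
        D (c 0) (c 1) * PE (L - 1) (fun i => P (c (i + 1))) := by
  obtain ⟨n, rfl⟩ := Nat.exists_eq_add_of_le' hL
  rw [show n + 2 - 1 = n + 1 from rfl, F1seq_succ, F1seq_succ, PE, Finset.sum_range_succ' _ n,
    Finset.sum_range_succ' _ n, mul_add, Finset.mul_sum, Finset.mul_sum, ← add_assoc,
    ← Finset.sum_add_distrib]
  congr 1
  · refine Finset.sum_congr rfl fun k _ => ?_
    rw [Finset.sum_range_succ', Finset.prod_range_succ']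
    ring
  · simp
end

section
/- (Equation 10) Let d = ⟨c_0, c_1,…,c_L⟩ (L ≥ 1) be a driving route with real pick-up probabilities P(c_i), real distances D, and constant D∞. Then F(d) = (1−P(c_1))·F1(c_1,…,c_L) + D_{c_0,c_1}·PE(P(c_1),…,P(c_L)) + D∞·(1 − PE(P(c_1),…,P(c_L))). -/
/-- The potential travel distance of a driving route `d = ⟨c_0, c_1,…,c_L⟩` (here `c i` is
the `i`-th point of the route, `c 0` the starting position):
`F(d) = Σ_{k=1}^{L} (Σ_{i=1}^{k} D_{c_{i−1},c_i})·(∏_{i=1}^{k−1}(1−P(c_i)))·P(c_k)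
        + D∞·∏_{i=1}^{L}(1−P(c_i))`. -/
noncomputable def Froute {α : Type*} (L : ℕ) (c : ℕ → α) (P : α → ℝ) (D : α → α → ℝ)
    (Dinf : ℝ) : ℝ :=
  (∑ k ∈ Finset.Icc 1 L,
    (∑ i ∈ Finset.Icc 1 k, D (c (i - 1)) (c i)) *
      ((∏ i ∈ Finset.Ico 1 k, (1 - P (c i))) * P (c k))) +
    Dinf * ∏ i ∈ Finset.Icc 1 L, (1 - P (c i))

/-- The probability that every trial fails is complementary to the probability summation
function. -/
theorem one_sub_PE (L : ℕ) (p : ℕ → ℝ) : 1 - PE L p = ∏ i ∈ Finset.range L, (1 - p i) := by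
  induction L with
  | zero => simp [PE]
  | succ n ih =>
    rw [Finset.prod_range_succ, ← ih, PE, Finset.sum_range_succ, ← PE, ← ih]
    ring

theorem Finset.prod_Ico_one_succ_eq_prod_range {M : Type*} [CommMonoid M] (f : ℕ → M) (k : ℕ) :
    ∏ i ∈ Finset.Ico 1 (k + 1), f i = ∏ i ∈ Finset.range k, f (i + 1) := by
  simp [Finset.prod_Ico_eq_prod_range, add_comm]

/-- The length of a route is the length of its first leg plus that of the remaining route. -/
theorem sum_dist_succ {α : Type*} (c : ℕ → α) (D : α → α → ℝ) (k : ℕ) :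
    ∑ i ∈ Finset.Icc 1 (k + 1), D (c (i - 1)) (c i) =
      D (c 0) (c 1) + ∑ i ∈ Finset.Icc 1 k, D (c (i - 1 + 1)) (c (i + 1)) := by
  induction k with
  | zero => simp
  | succ n ih =>
    rw [Finset.sum_Icc_succ_top (by omega), ih,
      Finset.sum_Icc_succ_top (b := n) (by omega), add_assoc]
    simp

/-- Equation 10: for a driving route `d = ⟨c_0, c_1,…,c_L⟩` (`L ≥ 1`),
`F(d) = (1−P(c_1))·F1(c_1,…,c_L) + D_{c_0,c_1}·PE(P(c_1),…,P(c_L))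
        + D∞·(1 − PE(P(c_1),…,P(c_L)))`. -/
theorem F_decomposition {α : Type*} (L : ℕ) (hL : 1 ≤ L) (c : ℕ → α)
    (P : α → ℝ) (D : α → α → ℝ) (Dinf : ℝ) :
    Froute L c P D Dinf =
      (1 - P (c 1)) * F1seq L (fun i => c (i + 1)) P D +
        D (c 0) (c 1) * PE L (fun i => P (c (i + 1))) +
        Dinf * (1 - PE L (fun i => P (c (i + 1)))) := by
  obtain ⟨n, rfl⟩ := Nat.exists_eq_add_of_le' hL
  rw [one_sub_PE]
  simp only [Froute, F1seq, PE, ← Finset.Ico_add_one_right_eq_Icc 1 (n + 1),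
    Finset.prod_Ico_one_succ_eq_prod_range]
  congr 1
  clear hL
  induction n with
  | zero => simp
  | succ n ih =>
    rw [Finset.sum_Ico_succ_top (by omega), ih, Finset.sum_Ico_succ_top (b := n + 1) (by omega),
      Finset.sum_range_succ _ (n + 1), sum_dist_succ, Finset.prod_Ico_one_succ_eq_prod_range,
      Finset.prod_Ico_one_succ_eq_prod_range, Finset.prod_range_succ']
    ring
end

section
/- (Route decomposition identity from the proof of Theorem 2) Let d_a = ⟨c_0, c_1,…,c_m, c_s, c_{a_1},…,c_{a_k}⟩ (m ≥ 0, k ≥ 0) be a driving route with real pick-up probabilities P, real distances D, and constant D∞. Let a = ⟨c_s, c_{a_1},…,c_{a_k}⟩, let D_0 = D_{c_0,c_1} + Σ_{i=1}^{m−1} D_{c_i,c_{i+1}} + D_{c_m,c_s} (so D_0 = D_{c_0,c_s} when m = 0), and let P̄_0 = ∏_{i=1}^{m}(1−P(c_i)). Then F(d_a) = F1(⟨c_0,c_1,…,c_m⟩) + D_0·P̄_0 + (D∞ − D_0)·P̄_0·(1 − PE(P(c_s),P(c_{a_1}),…,P(c_{a_k}))) + F1(a)·P̄_0·(1−P(c_s)).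 -/
/-- The route PTD sub-function of a route `⟨c_0, c_1,…,c_m⟩`:
`F1(⟨c_0,…,c_m⟩) = Σ_{k=1}^{m} (Σ_{i=1}^{k} D_{c_{i−1},c_i})·(∏_{i=1}^{k−1}(1−P(c_i)))·P(c_k)`,
which equals 0 when `m = 0`. -/
noncomputable def F1route {α : Type*} (m : ℕ) (c : ℕ → α) (P : α → ℝ) (D : α → α → ℝ) : ℝ :=
  ∑ k ∈ Finset.Icc 1 m,
    (∑ i ∈ Finset.Icc 1 k, D (c (i - 1)) (c i)) *
      ((∏ i ∈ Finset.Ico 1 k, (1 - P (c i))) * P (c k))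

/-- The sequence `⟨c_s, t_1, t_2, …⟩` (0-based: index 0 is `cs`, index `i ≥ 1` is `t (i-1)`). -/
def seqPts {α : Type*} (cs : α) (t : ℕ → α) : ℕ → α :=
  fun i => if i = 0 then cs else t (i - 1)

/-- The route `⟨c_0, c_1,…,c_m, c_s, t_1,…⟩`: index 0 is the starting point `c0`, indices
`1,…,m` are the prefix points `pre 0,…,pre (m-1)`, index `m+1` is `cs`, and index `m+1+j`
(`j ≥ 1`) is `t (j-1)`. -/
def routePts {α : Type*} (c0 : α) (m : ℕ) (pre : ℕ → α) (cs : α) (t : ℕ → α) : ℕ → α :=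
  fun i => if i = 0 then c0 else if i ≤ m then pre (i - 1)
    else if i = m + 1 then cs else t (i - m - 2)

theorem sum_Icc_one_shift {α : Type*} (c : ℕ → α) (D : α → α → ℝ) (n j : ℕ) :
    ∑ i ∈ Finset.Icc 1 (n + j), D (c (i - 1)) (c i) =
      ∑ i ∈ Finset.Icc 1 n, D (c (i - 1)) (c i) +
        ∑ i ∈ Finset.Icc 1 j, D (c (n + (i - 1))) (c (n + i)) := by
  induction j with
  | zero => simp
  | succ j ih =>
    rw [← add_assoc, Finset.sum_Icc_succ_top (by omega), ih, Finset.sum_Icc_succ_top (by omega)]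
    simp [add_assoc]

theorem prod_Ico_one_shift (q : ℕ → ℝ) (m j : ℕ) :
    ∏ i ∈ Finset.Ico 1 (m + 1 + j), q i =
      (∏ i ∈ Finset.range m, q (i + 1)) * ∏ i ∈ Finset.range j, q (m + 1 + i) := by
  rw [Finset.prod_Ico_eq_prod_range, show m + 1 + j - 1 = m + j by omega, Finset.prod_range_add]
  simp only [add_comm, add_left_comm, add_assoc]

theorem F1route_add_succ {α : Type*} (m k : ℕ) (c : ℕ → α) (P : α → ℝ) (D : α → α → ℝ) :
    F1route (m + 1 + k) c P D =
      F1route m c P D + (∏ i ∈ Finset.range m, (1 - P (c (i + 1)))) *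
        ((∑ i ∈ Finset.Icc 1 (m + 1), D (c (i - 1)) (c i)) *
            PE (k + 1) (fun i => P (c (m + 1 + i))) +
          (1 - P (c (m + 1))) * F1seq (k + 1) (fun i => c (m + 1 + i)) P D) := by
  induction k with
  | zero =>
    have h := prod_Ico_one_shift (fun i => 1 - P (c i)) m 0
    simp only [add_zero, Finset.range_zero, Finset.prod_empty, mul_one] at h
    have hF : F1route (m + 1) c P D = F1route m c P D +
        (∑ i ∈ Finset.Icc 1 (m + 1), D (c (i - 1)) (c i)) *
          ((∏ i ∈ Finset.Ico 1 (m + 1), (1 - P (c i))) * P (c (m + 1))) :=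
      Finset.sum_Icc_succ_top (by omega) _
    rw [add_zero, hF, h]
    simp [PE, F1seq]
    ring
  | succ k ih =>
    have hF : F1route (m + 1 + (k + 1)) c P D = F1route (m + 1 + k) c P D +
        (∑ i ∈ Finset.Icc 1 (m + 1 + (k + 1)), D (c (i - 1)) (c i)) *
          ((∏ i ∈ Finset.Ico 1 (m + 1 + (k + 1)), (1 - P (c i))) * P (c (m + 1 + (k + 1)))) :=
      Finset.sum_Icc_succ_top (by omega) _
    have hPE : PE (k + 1 + 1) (fun i => P (c (m + 1 + i))) =
        PE (k + 1) (fun i => P (c (m + 1 + i))) +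
          (∏ i ∈ Finset.range (k + 1), (1 - P (c (m + 1 + i)))) * P (c (m + 1 + (k + 1))) :=
      Finset.sum_range_succ _ _
    have hS : F1seq (k + 1 + 1) (fun i => c (m + 1 + i)) P D =
        F1seq (k + 1) (fun i => c (m + 1 + i)) P D +
          (∑ i ∈ Finset.Icc 1 (k + 1), D (c (m + 1 + (i - 1))) (c (m + 1 + i))) *
            ((∏ i ∈ Finset.Ico 1 (k + 1), (1 - P (c (m + 1 + i)))) * P (c (m + 1 + (k + 1)))) :=
      Finset.sum_Ico_succ_top (by omega) _
    have hprod : ∏ i ∈ Finset.range (k + 1), (1 - P (c (m + 1 + i))) =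
        (1 - P (c (m + 1))) * ∏ i ∈ Finset.Ico 1 (k + 1), (1 - P (c (m + 1 + i))) := by
      rw [Finset.range_eq_Ico, Finset.prod_eq_prod_Ico_succ_bot (by omega), add_zero]
    rw [hF, ih, hPE, hS, sum_Icc_one_shift c D (m + 1), prod_Ico_one_shift (fun i => 1 - P (c i)), hprod]
    ring

theorem Froute_eq {α : Type*} (L : ℕ) (c : ℕ → α) (P : α → ℝ) (D : α → α → ℝ) (Dinf : ℝ) :
    Froute L c P D Dinf =
      F1route L c P D + Dinf * ∏ i ∈ Finset.Icc 1 L, (1 - P (c i)) :=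
  rfl

theorem routePts_add_succ {α : Type*} (c0 cs : α) (m : ℕ) (pre t : ℕ → α) (i : ℕ) :
    routePts c0 m pre cs t (m + 1 + i) = seqPts cs t i := by
  rcases i with _ | i
  · simp [routePts, seqPts]
  · simp only [routePts, seqPts]
    rw [if_neg (by omega), if_neg (by omega), if_neg (by omega), if_neg (by omega)]
    congr 1
    omega

theorem routePts_succ_of_lt {α : Type*} (c0 cs : α) {m i : ℕ} (pre t : ℕ → α) (hi : i < m) :
    routePts c0 m pre cs t (i + 1) = pre i := by
  simp [routePts, Nat.succ_le_iff.mpr hi]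

/-- Route decomposition identity from the proof of Theorem 2:
for the route `d_a = ⟨c_0, c_1,…,c_m, c_s, c_{a_1},…,c_{a_k}⟩` (`m ≥ 0`, `k ≥ 0`),
with `a = ⟨c_s, c_{a_1},…,c_{a_k}⟩`, `D_0 = D_{c_0,c_1} + Σ_{i=1}^{m−1} D_{c_i,c_{i+1}} +
D_{c_m,c_s}` (so `D_0 = D_{c_0,c_s}` when `m = 0`) and `P̄_0 = ∏_{i=1}^{m}(1−P(c_i))`:
`F(d_a) = F1(⟨c_0,…,c_m⟩) + D_0·P̄_0 + (D∞ − D_0)·P̄_0·(1 − PE(P(c_s),P(c_{a_1}),…,P(c_{a_k})))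
          + F1(a)·P̄_0·(1−P(c_s))`. -/
theorem route_decomposition {α : Type*} (m k : ℕ) (c0 cs : α) (pre ta : ℕ → α)
    (P : α → ℝ) (D : α → α → ℝ) (Dinf : ℝ) (D0 Pbar0 : ℝ)
    (hD0 : D0 = ∑ i ∈ Finset.Icc 1 (m + 1),
      D (routePts c0 m pre cs ta (i - 1)) (routePts c0 m pre cs ta i))
    (hPbar0 : Pbar0 = ∏ i ∈ Finset.range m, (1 - P (pre i))) :
    Froute (m + 1 + k) (routePts c0 m pre cs ta) P D Dinf =
      F1route m (routePts c0 m pre cs ta) P D + D0 * Pbar0 +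
        (Dinf - D0) * Pbar0 * (1 - PE (k + 1) (fun i => P (seqPts cs ta i))) +
        F1seq (k + 1) (seqPts cs ta) P D * Pbar0 * (1 - P cs) := by
  have hP : ∏ i ∈ Finset.range m, (1 - P (routePts c0 m pre cs ta (i + 1))) = Pbar0 := by
    rw [hPbar0]
    refine Finset.prod_congr rfl fun i hi => ?_
    rw [routePts_succ_of_lt c0 cs pre ta (Finset.mem_range.mp hi)]
  have hs : routePts c0 m pre cs ta (m + 1) = cs := routePts_add_succ c0 cs m pre ta 0
  have hIcc : Finset.Icc 1 (m + 1 + k) = Finset.Ico 1 (m + 1 + (k + 1)) := by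
    ext
    simp
    omega
  rw [Froute_eq, F1route_add_succ, hIcc,
    prod_Ico_one_shift (fun i => 1 - P (routePts c0 m pre cs ta i)), hP, hs, ← hD0]
  simp only [routePts_add_succ]
  rw [← one_sub_PE]
  ring
end

section
/- (Difference identity from the proof of Theorem 2) Let d_a = ⟨c_0, c_1,…,c_m, c_s, c_{a_1},…,c_{a_k}⟩ and d_b = ⟨c_0, c_1,…,c_m, c_s, c_{b_1},…,c_{b_k}⟩ (m ≥ 0, k ≥ 0) be two driving routes with the same starting point c_0, the same prefix c_1,…,c_m, and the same point c_s, with real pick-up probabilities P, real distances D, and the same constant D∞. Let a = ⟨c_s, c_{a_1},…,c_{a_k}⟩ and b = ⟨c_s, c_{b_1},…,c_{b_k}⟩, let D_0 = D_{c_0,c_1} + Σ_{i=1}^{m−1} D_{c_i,c_{i+1}} + D_{c_m,c_s} and P̄_0 = ∏_{i=1}^{m}(1−P(c_i)). Then F(d_a) − F(d_b) = P̄_0·(1−P(c_s))·(F1(a) − F1(b)) + P̄_0·(D∞ − D_0)·(PE(b) − PE(a)), where PE(a) = PE(P(c_s),P(c_{a_1}),…,P(c_{a_k})) and PE(b) =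 PE(P(c_s),P(c_{b_1}),…,P(c_{b_k})). -/
theorem PE_eq_one_sub_prod (L : ℕ) (p : ℕ → ℝ) :
    PE L p = 1 - ∏ i ∈ Finset.range L, (1 - p i) := by
  induction L with
  | zero => simp [PE]
  | succ L ih =>
    unfold PE at ih ⊢
    rw [Finset.sum_range_succ, ih, Finset.prod_range_succ]
    ring

theorem sum_Icc_one_add {β : Type*} [AddCommMonoid β] (f : ℕ → β) (n k : ℕ) :
    ∑ i ∈ Finset.Icc 1 (n + k), f i =
      ∑ i ∈ Finset.Icc 1 n, f i + ∑ i ∈ Finset.Icc 1 k, f (n + i) := by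
  induction k with
  | zero => simp
  | succ k ih =>
    rw [← add_assoc, Finset.sum_Icc_succ_top (by omega), ih,
      Finset.sum_Icc_succ_top (by omega), add_assoc]
    rfl

theorem prod_Ico_one_add_succ {β : Type*} [CommMonoid β] (f : ℕ → β) (n k : ℕ) :
    ∏ i ∈ Finset.Ico 1 (n + 1 + k), f i =
      (∏ i ∈ Finset.range n, f (i + 1)) * ∏ i ∈ Finset.range k, f (n + 1 + i) := by
  rw [Finset.prod_Ico_eq_prod_range, show n + 1 + k - 1 = n + k by omega, Finset.prod_range_add]
  simp only [add_comm 1, add_right_comm]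

theorem F1route_add {α : Type*} (n k : ℕ) (c : ℕ → α) (P : α → ℝ) (D : α → α → ℝ) :
    F1route (n + 1 + k) c P D =
      F1route n c P D + (∏ i ∈ Finset.range n, (1 - P (c (i + 1)))) *
        ((1 - P (c (n + 1))) * F1seq (k + 1) (fun i => c (n + 1 + i)) P D +
          (∑ i ∈ Finset.Icc 1 (n + 1), D (c (i - 1)) (c i)) *
            PE (k + 1) (fun i => P (c (n + 1 + i)))) := by
  induction k with
  | zero =>
    have h := prod_Ico_one_add_succ (fun i => 1 - P (c i)) n 0
    simp only [add_zero, Finset.range_zero, Finset.prod_empty, mul_one] at h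
    simp only [F1route, F1seq, PE, add_zero, zero_add, Finset.Ico_self, Finset.sum_empty,
      Finset.range_one, Finset.sum_singleton, Finset.range_zero, Finset.prod_empty]
    rw [Finset.sum_Icc_succ_top (by omega), h]
    ring
  | succ k ih =>
    have hF : F1route (n + 1 + (k + 1)) c P D = F1route (n + 1 + k) c P D +
        (∑ i ∈ Finset.Icc 1 (n + 1 + (k + 1)), D (c (i - 1)) (c i)) *
          ((∏ i ∈ Finset.Ico 1 (n + 1 + (k + 1)), (1 - P (c i))) * P (c (n + 1 + (k + 1)))) :=
      Finset.sum_Icc_succ_top (by omega) _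
    have hS (s : ℕ → α) : F1seq (k + 1 + 1) s P D = F1seq (k + 1) s P D +
        (∑ i ∈ Finset.Icc 1 (k + 1), D (s (i - 1)) (s i)) *
          ((∏ i ∈ Finset.Ico 1 (k + 1), (1 - P (s i))) * P (s (k + 1))) :=
      Finset.sum_Ico_succ_top (by omega) _
    have hPE (p : ℕ → ℝ) : PE (k + 1 + 1) p = PE (k + 1) p +
        (∏ i ∈ Finset.range (k + 1), (1 - p i)) * p (k + 1) :=
      Finset.sum_range_succ _ _
    have hD : ∑ i ∈ Finset.Icc 1 (k + 1), D (c (n + 1 + i - 1)) (c (n + 1 + i)) =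
        ∑ i ∈ Finset.Icc 1 (k + 1), D (c (n + 1 + (i - 1))) (c (n + 1 + i)) :=
      Finset.sum_congr rfl fun i hi => by
        rw [Nat.add_sub_assoc (Finset.mem_Icc.mp hi).1]
    have hP : ∏ i ∈ Finset.range (k + 1), (1 - P (c (n + 1 + i))) =
        (1 - P (c (n + 1))) * ∏ i ∈ Finset.Ico 1 (k + 1), (1 - P (c (n + 1 + i))) := by
      rw [Finset.range_eq_Ico, Finset.prod_eq_prod_Ico_succ_bot (by omega)]
    rw [hF, ih, hS, hPE, sum_Icc_one_add _ (n + 1) (k + 1), prod_Ico_one_add_succ, hD, hP]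
    ring

theorem Froute_add {α : Type*} (n k : ℕ) (c : ℕ → α) (P : α → ℝ) (D : α → α → ℝ) (Dinf : ℝ) :
    Froute (n + 1 + k) c P D Dinf =
      F1route n c P D + (∏ i ∈ Finset.range n, (1 - P (c (i + 1)))) *
        ((1 - P (c (n + 1))) * F1seq (k + 1) (fun i => c (n + 1 + i)) P D +
          (∑ i ∈ Finset.Icc 1 (n + 1), D (c (i - 1)) (c i)) *
            PE (k + 1) (fun i => P (c (n + 1 + i))) +
          Dinf * (1 - PE (k + 1) (fun i => P (c (n + 1 + i))))) := by
  have h : Froute (n + 1 + k) c P D Dinf = F1route (n + 1 + k) c P D +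
      Dinf * ∏ i ∈ Finset.Ico 1 (n + 1 + (k + 1)), (1 - P (c i)) := rfl
  rw [h, F1route_add, prod_Ico_one_add_succ, PE_eq_one_sub_prod]
  ring

theorem routePts_eq_of_le {α : Type*} (c0 : α) (m : ℕ) (pre : ℕ → α) (cs : α) (t t' : ℕ → α)
    {i : ℕ} (hi : i ≤ m + 1) : routePts c0 m pre cs t i = routePts c0 m pre cs t' i := by
  unfold routePts
  split_ifs <;> first | rfl | omega

theorem routePts_add {α : Type*} (c0 : α) (m : ℕ) (pre : ℕ → α) (cs : α) (t : ℕ → α) (i : ℕ) :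
    routePts c0 m pre cs t (m + 1 + i) = seqPts cs t i := by
  unfold routePts seqPts
  split_ifs <;> first | rfl | omega | (congr 1; omega)

theorem sum_dist_routePts_eq {α : Type*} (c0 : α) (m : ℕ) (pre : ℕ → α) (cs : α)
    (t t' : ℕ → α) (D : α → α → ℝ) {k : ℕ} (hk : k ≤ m + 1) :
    ∑ i ∈ Finset.Icc 1 k, D (routePts c0 m pre cs t (i - 1)) (routePts c0 m pre cs t i) =
      ∑ i ∈ Finset.Icc 1 k,
        D (routePts c0 m pre cs t' (i - 1)) (routePts c0 m pre cs t' i) := by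
  refine Finset.sum_congr rfl fun i hi => ?_
  have := Finset.mem_Icc.mp hi
  rw [routePts_eq_of_le c0 m pre cs t t' (by omega : i ≤ m + 1),
    routePts_eq_of_le c0 m pre cs t t' (by omega : i - 1 ≤ m + 1)]

theorem F1route_routePts_eq {α : Type*} (c0 : α) (m : ℕ) (pre : ℕ → α) (cs : α)
    (t t' : ℕ → α) (P : α → ℝ) (D : α → α → ℝ) :
    F1route m (routePts c0 m pre cs t) P D = F1route m (routePts c0 m pre cs t') P D := by
  refine Finset.sum_congr rfl fun k hk => ?_
  have hk := Finset.mem_Icc.mp hk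
  rw [sum_dist_routePts_eq c0 m pre cs t t' D (by omega),
    routePts_eq_of_le c0 m pre cs t t' (by omega : k ≤ m + 1)]
  congr 2
  refine Finset.prod_congr rfl fun i hi => ?_
  have := Finset.mem_Ico.mp hi
  rw [routePts_eq_of_le c0 m pre cs t t' (by omega : i ≤ m + 1)]

theorem Froute_routePts {α : Type*} (m k : ℕ) (c0 cs : α) (pre t : ℕ → α)
    (P : α → ℝ) (D : α → α → ℝ) (Dinf : ℝ) :
    Froute (m + 1 + k) (routePts c0 m pre cs t) P D Dinf =
      F1route m (routePts c0 m pre cs t) P D + (∏ i ∈ Finset.range m, (1 - P (pre i))) *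
        ((1 - P cs) * F1seq (k + 1) (seqPts cs t) P D +
          (∑ i ∈ Finset.Icc 1 (m + 1),
            D (routePts c0 m pre cs t (i - 1)) (routePts c0 m pre cs t i)) *
            PE (k + 1) (fun i => P (seqPts cs t i)) +
          Dinf * (1 - PE (k + 1) (fun i => P (seqPts cs t i)))) := by
  have hcs : routePts c0 m pre cs t (m + 1) = cs := routePts_add c0 m pre cs t 0
  have hpre : ∏ i ∈ Finset.range m, (1 - P (routePts c0 m pre cs t (i + 1))) =
      ∏ i ∈ Finset.range m, (1 - P (pre i)) :=
    Finset.prod_congr rfl fun i hi => by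
      have : i + 1 ≤ m := Finset.mem_range.mp hi
      simp [routePts, this]
  rw [Froute_add, hcs, hpre]
  simp only [routePts_add]

/-- Difference identity from the proof of Theorem 2: for two driving routes
`d_a = ⟨c_0, c_1,…,c_m, c_s, c_{a_1},…,c_{a_k}⟩` and
`d_b = ⟨c_0, c_1,…,c_m, c_s, c_{b_1},…,c_{b_k}⟩` (`m ≥ 0`, `k ≥ 0`) with the same starting
point, prefix and point `c_s`, with `a = ⟨c_s, c_{a_1},…,c_{a_k}⟩`,
`b = ⟨c_s, c_{b_1},…,c_{b_k}⟩`, `D_0 = D_{c_0,c_1} + Σ_{i=1}^{m−1} D_{c_i,c_{i+1}} + D_{c_m,c_s}`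
and `P̄_0 = ∏_{i=1}^{m}(1−P(c_i))`:
`F(d_a) − F(d_b) = P̄_0·(1−P(c_s))·(F1(a) − F1(b)) + P̄_0·(D∞ − D_0)·(PE(b) − PE(a))`. -/
theorem route_difference {α : Type*} (m k : ℕ) (c0 cs : α) (pre ta tb : ℕ → α)
    (P : α → ℝ) (D : α → α → ℝ) (Dinf : ℝ) (D0 Pbar0 : ℝ)
    (hD0 : D0 = ∑ i ∈ Finset.Icc 1 (m + 1),
      D (routePts c0 m pre cs ta (i - 1)) (routePts c0 m pre cs ta i))
    (hPbar0 : Pbar0 = ∏ i ∈ Finset.range m, (1 - P (pre i))) :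
    Froute (m + 1 + k) (routePts c0 m pre cs ta) P D Dinf -
        Froute (m + 1 + k) (routePts c0 m pre cs tb) P D Dinf =
      Pbar0 * (1 - P cs) *
          (F1seq (k + 1) (seqPts cs ta) P D - F1seq (k + 1) (seqPts cs tb) P D) +
        Pbar0 * (Dinf - D0) *
          (PE (k + 1) (fun i => P (seqPts cs tb i)) -
            PE (k + 1) (fun i => P (seqPts cs ta i))) := by
  rw [Froute_routePts, Froute_routePts, F1route_routePts_eq c0 m pre cs tb ta,
    sum_dist_routePts_eq c0 m pre cs tb ta D le_rfl, ← hD0, ← hPbar0]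
  ring
end

section
/- (Corollary 1, batch pruning) Let a = ⟨c_s, c_{a_1},…,c_{a_k}⟩ and b = ⟨c_s, c_{b_1},…,c_{b_k}⟩ (k ≥ 0) be two point sequences with the same source point c_s, pick-up probabilities P, distances D, and constant D∞. Assume P(c_s) < 1 and assume either (F1(a) ≤ F1(b) and 1 − PE(a) < 1 − PE(b)) or (F1(a) < F1(b) and 1 − PE(a) ≤ 1 − PE(b)), where PE(a) = PE(P(c_s),P(c_{a_1}),…,P(c_{a_k})) and PE(b) = PE(P(c_s),P(c_{b_1}),…,P(c_{b_k})). Then for every starting point c_0 with D∞ > D_{c_0,c_s}, the routes d_a = ⟨c_0, c_s, c_{a_1},…,c_{a_k}⟩ and d_b = ⟨c_0, c_s, c_{b_1},…,c_{b_k}⟩ satisfy F(d_a) < F(d_b). -/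
theorem seqPts_succ {α : Type*} (c : α) (s : ℕ → α) (n : ℕ) : seqPts c s (n + 1) = s n := by
  simp [seqPts]

theorem sum_dist_seqPts {α : Type*} (D : α → α → ℝ) (c : α) (s : ℕ → α) (n : ℕ) :
    ∑ i ∈ Finset.Icc 1 (n + 1), D (seqPts c s (i - 1)) (seqPts c s i) =
      D c (s 0) + ∑ i ∈ Finset.Icc 1 n, D (s (i - 1)) (s i) := by
  induction n with
  | zero => simp [seqPts]
  | succ n ih =>
    rw [Finset.sum_Icc_succ_top (by lia), ih, Finset.sum_Icc_succ_top (by lia)]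
    simp only [Nat.add_sub_cancel, seqPts_succ]
    ring

theorem prod_Ico_seqPts {α : Type*} (P : α → ℝ) (c : α) (s : ℕ → α) (n : ℕ) :
    ∏ i ∈ Finset.Ico 1 (n + 1), (1 - P (seqPts c s i)) =
      ∏ i ∈ Finset.range n, (1 - P (s i)) := by
  simp [Finset.prod_Ico_eq_prod_range, add_comm 1, seqPts_succ]

theorem prod_Ico_one_mul {α : Type*} (P : α → ℝ) (s : ℕ → α) (n : ℕ) :
    ∏ i ∈ Finset.range (n + 1), (1 - P (s i)) =
      (1 - P (s 0)) * ∏ i ∈ Finset.Ico 1 (n + 1), (1 - P (s i)) := by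
  rw [Finset.range_eq_Ico, Finset.prod_eq_prod_Ico_succ_bot (by lia)]

/-- The potential travel distance of a route splits into an affine combination of the
sub-function and the failure probability of the sequence following the starting point. -/
theorem Froute_seqPts {α : Type*} (k : ℕ) (c : α) (s : ℕ → α) (P : α → ℝ) (D : α → α → ℝ)
    (Dinf : ℝ) :
    Froute (k + 1) (seqPts c s) P D Dinf =
      D c (s 0) + (1 - P (s 0)) * F1seq (k + 1) s P D +
        (Dinf - D c (s 0)) * (1 - PE (k + 1) (fun i => P (s i))) := by
  have hprod (n : ℕ) : ∏ i ∈ Finset.Icc 1 n, (1 - P (seqPts c s i)) =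
      ∏ i ∈ Finset.range n, (1 - P (s i)) := prod_Ico_seqPts P c s n
  simp only [one_sub_PE, Froute, hprod]
  induction k with
  | zero =>
    simp [F1seq, seqPts]
    ring
  | succ k ih =>
    have hF : F1seq (k + 1 + 1) s P D = F1seq (k + 1) s P D +
        (∑ i ∈ Finset.Icc 1 (k + 1), D (s (i - 1)) (s i)) *
          ((∏ i ∈ Finset.Ico 1 (k + 1), (1 - P (s i))) * P (s (k + 1))) :=
      Finset.sum_Ico_succ_top (by lia) _
    rw [Finset.sum_Icc_succ_top (by lia), sum_dist_seqPts, prod_Ico_seqPts, seqPts_succ, hF,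
      Finset.prod_range_succ _ (k + 1)]
    linear_combination ih + (∑ i ∈ Finset.Icc 1 (k + 1), D (s (i - 1)) (s i)) * P (s (k + 1)) *
      prod_Ico_one_mul P s k

/-- Corollary 1, batch pruning: let `a = ⟨c_s, c_{a_1},…,c_{a_k}⟩` and
`b = ⟨c_s, c_{b_1},…,c_{b_k}⟩` (`k ≥ 0`) share the source point `c_s` with `P(c_s) < 1`.
If `(F1(a) ≤ F1(b) ∧ 1 − PE(a) < 1 − PE(b))` or `(F1(a) < F1(b) ∧ 1 − PE(a) ≤ 1 − PE(b))`,
then for every starting point `c_0` with `D∞ > D_{c_0,c_s}`, the routes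
`d_a = ⟨c_0, c_s, c_{a_1},…,c_{a_k}⟩` and `d_b = ⟨c_0, c_s, c_{b_1},…,c_{b_k}⟩` satisfy
`F(d_a) < F(d_b)`. -/
theorem batch_pruning {α : Type*} (k : ℕ) (cs : α) (ta tb : ℕ → α)
    (P : α → ℝ) (D : α → α → ℝ) (Dinf : ℝ)
    (hcs : P cs < 1)
    (hprec :
      (F1seq (k + 1) (seqPts cs ta) P D ≤ F1seq (k + 1) (seqPts cs tb) P D ∧
        1 - PE (k + 1) (fun i => P (seqPts cs ta i)) <
          1 - PE (k + 1) (fun i => P (seqPts cs tb i))) ∨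
      (F1seq (k + 1) (seqPts cs ta) P D < F1seq (k + 1) (seqPts cs tb) P D ∧
        1 - PE (k + 1) (fun i => P (seqPts cs ta i)) ≤
          1 - PE (k + 1) (fun i => P (seqPts cs tb i)))) :
    ∀ c0 : α, Dinf > D c0 cs →
      Froute (k + 1) (seqPts c0 (seqPts cs ta)) P D Dinf <
        Froute (k + 1) (seqPts c0 (seqPts cs tb)) P D Dinf := by
  intro c0 hD
  have hP : 0 < 1 - P cs := sub_pos.mpr hcs
  have hD' : 0 < Dinf - D c0 cs := sub_pos.mpr hD
  have h0 (t : ℕ → α) : seqPts cs t 0 = cs := rfl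
  rw [Froute_seqPts, Froute_seqPts, h0, h0]
  rcases hprec with ⟨hF, hPE⟩ | ⟨hF, hPE⟩
  · linarith [mul_le_mul_of_nonneg_left hF hP.le, mul_lt_mul_of_pos_left hPE hD']
  · linarith [mul_lt_mul_of_pos_left hF hP, mul_le_mul_of_nonneg_left hPE hD'.le]
end

section
/- (Dominance implies precedence) Let a route of length L ≥ 1 from a starting point be described by leg distances e_1,…,e_L ≥ 0 and failure probabilities q_1,…,q_L with 0 < q_i < 1 for all i, and define F(e,q) = Σ_{k=1}^{L} (Σ_{i=1}^{k} e_i)·(∏_{i=1}^{k−1} q_i)·(1−q_k) + D∞·∏_{i=1}^{L} q_i. Let e′_1,…,e′_L ≥ 0 and q′_1,…,q′_L with 0 < q′_i < 1 satisfy e_i ≤ e′_i and q_i ≤ q′_i for every i, with strict inequality in at least one coordinate, and assume D∞ > Σ_{i=1}^{L} e′_i. Then F(e,q) < F(e′,q′); that is, if one route dominates another componentwise in leg distances and failure probabilities, its potential travel distance is strictly smaller. -/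
/-- The potential travel distance of a route of length `L` described by its leg distances
`e_1,…,e_L` and failure probabilities `q_1,…,q_L` (0-based: `e 0,…,e (L-1)` and
`q 0,…,q (L-1)`):
`F(e,q) = Σ_{k=1}^{L} (Σ_{i=1}^{k} e_i)·(∏_{i=1}^{k−1} q_i)·(1−q_k) + D∞·∏_{i=1}^{L} q_i`. -/
noncomputable def Flegs (L : ℕ) (e q : ℕ → ℝ) (Dinf : ℝ) : ℝ :=
  (∑ k ∈ Finset.range L,
    (∑ i ∈ Finset.range (k + 1), e i) * ((∏ i ∈ Finset.range k, q i) * (1 - q k))) +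
    Dinf * ∏ i ∈ Finset.range L, q i

theorem Flegs_eq_sum_mul_prod (L : ℕ) (e q : ℕ → ℝ) (Dinf : ℝ) :
    Flegs L e q Dinf = ∑ k ∈ Finset.range L, e k * ∏ i ∈ Finset.range k, q i +
      (Dinf - ∑ i ∈ Finset.range L, e i) * ∏ i ∈ Finset.range L, q i := by
  unfold Flegs
  induction L with
  | zero => simp
  | succ n ih =>
    rw [Finset.sum_range_succ, Finset.sum_range_succ (fun k => e k * _),
      Finset.prod_range_succ, Finset.sum_range_succ e]
    linear_combination ih

theorem Flegs_eq_sum_mul_sub (L : ℕ) (e q : ℕ → ℝ) (Dinf : ℝ) :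
    Flegs L e q Dinf = ∑ k ∈ Finset.range L,
      e k * (∏ i ∈ Finset.range k, q i - ∏ i ∈ Finset.range L, q i) +
      Dinf * ∏ i ∈ Finset.range L, q i := by
  rw [Flegs_eq_sum_mul_prod]
  simp only [mul_sub, Finset.sum_sub_distrib, ← Finset.sum_mul]
  ring

theorem prod_range_lt_prod_range {L k : ℕ} (hk : k < L) {q : ℕ → ℝ}
    (hq0 : ∀ i < L, 0 < q i) (hq1 : ∀ i < L, q i < 1) :
    ∏ i ∈ Finset.range L, q i < ∏ i ∈ Finset.range k, q i := by
  have hpos : ∀ n ≤ L, 0 < ∏ i ∈ Finset.range n, q i := fun n hn =>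
    Finset.prod_pos fun i hi => hq0 i ((Finset.mem_range.1 hi).trans_le hn)
  have hstep : ∀ n < L, ∏ i ∈ Finset.range (n + 1), q i < ∏ i ∈ Finset.range n, q i := by
    intro n hn
    rw [Finset.prod_range_succ]
    exact mul_lt_of_lt_one_right (hpos n hn.le) (hq1 n hn)
  have key : ∀ m, k + 1 ≤ m → m ≤ L →
      ∏ i ∈ Finset.range m, q i < ∏ i ∈ Finset.range k, q i := by
    intro m hm
    induction m, hm using Nat.le_induction with
    | base => exact fun _ => hstep k hk
    | succ n hn ih => exact fun h => (hstep n h).trans (ih (by omega))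
  exact key L hk le_rfl

/-- Dominance implies precedence: if a route with leg distances
`e_1,…,e_L ≥ 0` and failure probabilities `0 < q_i < 1` dominates another route
(`e'_i ≥ 0`, `0 < q'_i < 1`) componentwise, i.e. `e_i ≤ e'_i` and `q_i ≤ q'_i` for all `i`
with strict inequality in at least one coordinate, and `D∞ > Σ_{i=1}^{L} e'_i`, then
`F(e,q) < F(e',q')`. -/
theorem dominance_implies_precedence (L : ℕ) (hL : 1 ≤ L) (e q e' q' : ℕ → ℝ)
    (Dinf : ℝ)
    (he : ∀ i < L, 0 ≤ e i) (hq0 : ∀ i < L, 0 < q i) (hq1 : ∀ i < L, q i < 1)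
    (he' : ∀ i < L, 0 ≤ e' i) (hq'0 : ∀ i < L, 0 < q' i) (hq'1 : ∀ i < L, q' i < 1)
    (hdom : ∀ i < L, e i ≤ e' i ∧ q i ≤ q' i)
    (hstrict : ∃ i < L, e i < e' i ∨ q i < q' i)
    (hDinf : Dinf > ∑ i ∈ Finset.range L, e' i) :
    Flegs L e q Dinf < Flegs L e' q' Dinf := by
  have hle : Flegs L e q Dinf ≤ Flegs L e' q Dinf := by
    rw [Flegs_eq_sum_mul_sub, Flegs_eq_sum_mul_sub]
    gcongr with k hk
    · exact sub_nonneg.2 (prod_range_lt_prod_range (Finset.mem_range.1 hk) hq0 hq1).le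
    · exact (hdom k (Finset.mem_range.1 hk)).1
  have hprod : ∀ k ≤ L, ∏ i ∈ Finset.range k, q i ≤ ∏ i ∈ Finset.range k, q' i :=
    fun k hk => Finset.prod_le_prod
      (fun i hi => (hq0 i ((Finset.mem_range.1 hi).trans_le hk)).le)
      (fun i hi => (hdom i ((Finset.mem_range.1 hi).trans_le hk)).2)
  have hsum : ∑ k ∈ Finset.range L, e' k * ∏ i ∈ Finset.range k, q i ≤
      ∑ k ∈ Finset.range L, e' k * ∏ i ∈ Finset.range k, q' i :=
    Finset.sum_le_sum fun k hk => mul_le_mul_of_nonneg_left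
      (hprod k (Finset.mem_range.1 hk).le) (he' k (Finset.mem_range.1 hk))
  have hD : 0 < Dinf - ∑ i ∈ Finset.range L, e' i := sub_pos.2 hDinf
  obtain ⟨j, hj, hej | hqj⟩ := hstrict
  · refine lt_of_lt_of_le (b := Flegs L e' q Dinf) ?_ ?_
    · rw [Flegs_eq_sum_mul_sub, Flegs_eq_sum_mul_sub]
      refine add_lt_add_left (Finset.sum_lt_sum (fun k hk => ?_)
        ⟨j, Finset.mem_range.2 hj, ?_⟩) _
      · exact mul_le_mul_of_nonneg_right (hdom k (Finset.mem_range.1 hk)).1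
          (sub_nonneg.2 (prod_range_lt_prod_range (Finset.mem_range.1 hk) hq0 hq1).le)
      · exact mul_lt_mul_of_pos_right hej
          (sub_pos.2 (prod_range_lt_prod_range hj hq0 hq1))
    · rw [Flegs_eq_sum_mul_prod, Flegs_eq_sum_mul_prod]
      exact add_le_add hsum (mul_le_mul_of_nonneg_left (hprod L le_rfl) hD.le)
  · refine lt_of_le_of_lt hle ?_
    rw [Flegs_eq_sum_mul_prod, Flegs_eq_sum_mul_prod]
    refine add_lt_add_of_le_of_lt hsum (mul_lt_mul_of_pos_left ?_ hD)
    exact Finset.prod_lt_prod (fun i hi => hq0 i (Finset.mem_range.1 hi))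
      (fun i hi => (hdom i (Finset.mem_range.1 hi)).2) ⟨j, Finset.mem_range.2 hj, hqj⟩
end
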